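/- arXiv:2112.06811 — 9 statements merged into one kernel-verified Lean document; each statement's English description precedes it below -/
import Mathlib

section
/- Under Assumptions 1 and 2, the value function of the manipulation stage is continuous: for every contract Y with 0 ≤ Y(w) ≤ M for all w ∈ [0, M] satisfying Assumption 2, the function V is continuous on [0, M]. -/
/-- Assumption 1: the manipulation technology `g` vanishes for non-positive
manipulations, is convex on `[0, M]`, is differentiable on `(0, M)` with
derivative at least `1`, and tends to `0` as `z → 0⁺`. -/
def Assumption1 (M : ℝ) (g : ℝ → ℝ) : Prop :=
  (∀ z ≤ (0 : ℝ), g z = 0) ∧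
  ConvexOn ℝ (Set.Icc 0 M) g ∧
  (∀ z ∈ Set.Ioo (0 : ℝ) M, DifferentiableAt ℝ g z ∧ 1 ≤ deriv g z) ∧
  Filter.Tendsto g (nhdsWithin 0 (Set.Ioi 0)) (nhds 0)

/-- Assumption 2: for every `x ∈ [0, M]`, `limsup_{x' → x} Y(x') = Y(x)`. -/
def Assumption2 (M : ℝ) (Y : ℝ → ℝ) : Prop :=
  ∀ x ∈ Set.Icc (0 : ℝ) M, Filter.limsup Y (nhdsWithin x (Set.Icc 0 M)) = Y x

/-- Value function of the manipulation stage: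
`V(x) = sup_{w ∈ [0, M]} (Y(w) − g(w − x))`. -/
noncomputable def valueFun (M : ℝ) (g Y : ℝ → ℝ) (x : ℝ) : ℝ :=
  sSup ((fun w => Y w - g (w - x)) '' Set.Icc 0 M)

theorem Assumption1.continuousAt {M : ℝ} {g : ℝ → ℝ} (hg : Assumption1 M g)
    {z : ℝ} (hz : z < M) : ContinuousAt g z := by
  obtain ⟨hneg, -, hdiff, hlim⟩ := hg
  rcases lt_trichotomy z 0 with h | rfl | h
  · have : g =ᶠ[nhds z] fun _ => 0 := by
      filter_upwards [Iio_mem_nhds h] with y hy using hneg y (le_of_lt hy)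
    exact continuousAt_const.congr this.symm
  · refine continuousAt_iff_continuous_left'_right'.2 ⟨?_, ?_⟩
    · exact continuousWithinAt_const.congr (fun y hy => hneg y (le_of_lt hy)) (hneg 0 le_rfl)
    · simpa only [ContinuousWithinAt, hneg 0 le_rfl] using hlim
  · exact (hdiff z ⟨h, hz⟩).1.continuousAt

theorem Assumption1.self_le {M : ℝ} (hM : 0 < M) {g : ℝ → ℝ} (hg : Assumption1 M g)
    {z : ℝ} (hz : z ≤ M) : z ≤ g z := by
  have interior_le : ∀ y, 0 ≤ y → y < M → y ≤ g y := by
    intro y hy hyM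
    have key := (convex_Ico (0 : ℝ) M).mul_sub_le_image_sub_of_le_deriv (f := g) (C := 1)
      (fun u hu => (hg.continuousAt hu.2).continuousWithinAt)
      (fun u hu => (hg.2.2.1 u (by simpa using hu)).1.differentiableWithinAt)
      (fun u hu => (hg.2.2.1 u (by simpa using hu)).2)
      0 ⟨le_rfl, hM⟩ y ⟨hy, hyM⟩ hy
    rw [hg.1 0 le_rfl] at key
    linarith
  rcases lt_or_ge z 0 with h0 | h0
  · rw [hg.1 z h0.le]
    exact h0.le
  rcases hz.lt_or_eq with h | rfl
  · exact interior_le z h0 h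
  · have hconv := hg.2.1.2 (Set.left_mem_Icc.2 hM.le) (Set.right_mem_Icc.2 hM.le)
      (by norm_num : (0 : ℝ) ≤ 1 / 2) (by norm_num : (0 : ℝ) ≤ 1 / 2) (by norm_num)
    have hhalf := interior_le (1 / 2 * z) (by linarith) (by linarith)
    simp only [smul_eq_mul, mul_zero, zero_add, hg.1 0 le_rfl] at hconv
    linarith

/-- Although `g` may jump at `M`, its truncation at the level `M` does not. -/
theorem Assumption1.continuousOn_min {M : ℝ} (hM : 0 < M) {g : ℝ → ℝ} (hg : Assumption1 M g) :
    ContinuousOn (fun z => min (g z) M) (Set.Icc (-M) M) := by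
  intro z hz
  rcases hz.2.lt_or_eq with h | rfl
  · exact ContinuousAt.continuousWithinAt
      (Filter.Tendsto.min (hg.continuousAt h) tendsto_const_nhds)
  · have hval : min (g z) z = z := min_eq_right (hg.self_le hM le_rfl)
    rw [ContinuousWithinAt, hval]
    refine tendsto_of_tendsto_of_tendsto_of_le_of_le' (g := id) (h := fun _ => z)
      (continuous_id.continuousWithinAt) tendsto_const_nhds ?_ ?_
    · filter_upwards [self_mem_nhdsWithin] with y hy using le_min (hg.self_le hM hy.2) hy.2
    · exact Filter.Eventually.of_forall fun y => min_le_right _ _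

theorem sub_min_le_valueFun {M : ℝ} (hM : 0 < M) {g : ℝ → ℝ} (hg : Assumption1 M g)
    {Y : ℝ → ℝ} (hY : ∀ w ∈ Set.Icc (0 : ℝ) M, 0 ≤ Y w ∧ Y w ≤ M)
    {x w : ℝ} (hx : x ∈ Set.Icc 0 M) (hw : w ∈ Set.Icc 0 M) :
    Y w - min (g (w - x)) M ≤ valueFun M g Y x := by
  have hnonneg : ∀ z ≤ M, 0 ≤ g z := by
    intro z hz
    rcases le_total z 0 with h | h
    · exact (hg.1 z h).ge
    · exact h.trans (hg.self_le hM hz)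
  have hbdd : BddAbove ((fun w => Y w - g (w - x)) '' Set.Icc 0 M) := by
    refine ⟨M, ?_⟩
    rintro _ ⟨v, hv, rfl⟩
    have := hnonneg (v - x) (by linarith [hv.2, hx.1])
    have := (hY v hv).2
    dsimp only
    linarith
  have hle : ∀ v ∈ Set.Icc 0 M, Y v - g (v - x) ≤ valueFun M g Y x :=
    fun v hv => le_csSup hbdd ⟨v, hv, rfl⟩
  rcases le_total (g (w - x)) M with h | h
  · rw [min_eq_left h]
    exact hle w hw
  · have hzero := hle 0 ⟨le_rfl, hM.le⟩
    rw [hg.1 (0 - x) (by linarith [hx.1])] at hzero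
    rw [min_eq_right h]
    linarith [(hY w hw).2, (hY 0 ⟨le_rfl, hM.le⟩).1]

/-- under Assumptions 1 and 2 the value function of the
manipulation stage is continuous on `[0, M]`. -/
theorem value_function_continuous
    (M : ℝ) (hM : 0 < M) (g : ℝ → ℝ) (hg : Assumption1 M g)
    (Y : ℝ → ℝ) (hY : ∀ w ∈ Set.Icc (0 : ℝ) M, 0 ≤ Y w ∧ Y w ≤ M)
    (hY2 : Assumption2 M Y) :
    ContinuousOn (valueFun M g Y) (Set.Icc 0 M) := by
  have huc := isCompact_Icc.uniformContinuousOn_of_continuous (hg.continuousOn_min hM)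
  refine UniformContinuousOn.continuousOn (Metric.uniformContinuousOn_iff_le.2 fun ε hε => ?_)
  obtain ⟨δ, hδ, hclose⟩ := Metric.uniformContinuousOn_iff_le.1 huc ε hε
  have hle : ∀ x ∈ Set.Icc 0 M, ∀ x' ∈ Set.Icc 0 M, dist x x' ≤ δ →
      valueFun M g Y x ≤ valueFun M g Y x' + ε := by
    intro x hx x' hx' hd
    refine csSup_le ((Set.nonempty_Icc.2 hM.le).image _) ?_
    rintro _ ⟨w, hw, rfl⟩
    have hdiff := hclose (w - x) ⟨by linarith [hw.1, hx.2], by linarith [hw.2, hx.1]⟩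
      (w - x') ⟨by linarith [hw.1, hx'.2], by linarith [hw.2, hx'.1]⟩ (by rwa [dist_sub_left])
    rw [Real.dist_eq, abs_le] at hdiff
    have := sub_min_le_valueFun hM hg hY hx' hw
    have := min_le_left (g (w - x)) M
    dsimp only
    linarith [hdiff.1]
  refine ⟨δ, hδ, fun x hx x' hx' hd => ?_⟩
  rw [Real.dist_eq, abs_le]
  constructor
  · linarith [hle x' hx' x hx (by rwa [dist_comm])]
  · linarith [hle x hx x' hx' hd]
end

section
/- Under Assumptions 1 and 2, the value function of the manipulation stage is Lipschitz continuous: for every contract Y with 0 ≤ Y(w) ≤ M for all w ∈ [0, M] satisfying Assumption 2, there exists a constant L ≥ 0 such that |V(x) − V(x')| ≤ L·|x − x'| for all x, x' ∈ [0, M]. -/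
/-- Under Assumption 1, increments of `g` on `[0, M]` dominate increments of the identity. -/
lemma Assumption1.sub_le_sub {M : ℝ} {g : ℝ → ℝ} (hg : Assumption1 M g) {a b : ℝ}
    (ha : 0 ≤ a) (hab : a ≤ b) (hb : b ≤ M) : b - a ≤ g b - g a := by
  obtain ⟨h0, hconv, hdiff, hlim⟩ := hg
  have hpos : ∀ c, 0 < c → c < b → b - c ≤ g b - g c := by
    intro c hc hcb
    have hd := hdiff c ⟨hc, hcb.trans_le hb⟩
    have h := hd.2.trans (hconv.deriv_le_slope ⟨hc.le, hcb.le.trans hb⟩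
      ⟨hc.le.trans hcb.le, hb⟩ hcb hd.1)
    rw [slope_def_field, le_div_iff₀ (sub_pos.2 hcb)] at h
    linarith
  rcases hab.eq_or_lt with rfl | hab
  · simp
  rcases ha.eq_or_lt with rfl | ha
  · rw [h0 0 le_rfl]
    have hid : Filter.Tendsto (fun c : ℝ => b - c) (nhdsWithin 0 (Set.Ioi 0)) (nhds (b - 0)) :=
      (tendsto_const_nhds.sub Filter.tendsto_id).mono_left nhdsWithin_le_nhds
    refine le_of_tendsto_of_tendsto hid (tendsto_const_nhds.sub hlim) ?_
    filter_upwards [Ioo_mem_nhdsGT hab] with c hc using hpos c hc.1 hc.2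
  · exact hpos a ha hab

lemma Assumption1.monotoneOn {M : ℝ} {g : ℝ → ℝ} (hg : Assumption1 M g) :
    MonotoneOn g (Set.Iic M) := by
  intro a _ b hb hab
  rcases le_total b 0 with hb0 | hb0
  · rw [hg.1 b hb0, hg.1 a (hab.trans hb0)]
  rcases le_total a 0 with ha0 | ha0
  · have := hg.sub_le_sub le_rfl hb0 hb
    rw [hg.1 0 le_rfl] at this
    rw [hg.1 a ha0]
    linarith
  · linarith [hg.sub_le_sub ha0 hab hb]

/-- Costs truncated at the maximal payment `M` have bounded slope, although `g` itself may be
arbitrarily steep near `M`. -/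
lemma Assumption1.exists_min_sub_min_le {M : ℝ} (hM : 0 < M) {g : ℝ → ℝ} (hg : Assumption1 M g) :
    ∃ L : ℝ, 0 ≤ L ∧ ∀ a b, a ≤ b → b ≤ M → min (g b) M - min (g a) M ≤ L * (b - a) := by
  suffices h : ∃ L : ℝ, 0 ≤ L ∧ ∀ a b, 0 ≤ a → a < b → b ≤ M →
      min (g b) M - min (g a) M ≤ L * (b - a) by
    obtain ⟨L, hL, h⟩ := h
    refine ⟨L, hL, fun a b hab hb => ?_⟩
    rcases hab.eq_or_lt with rfl | hab'
    · simp
    rcases le_or_gt b 0 with hb0 | hb0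
    · rw [hg.1 b hb0, hg.1 a (hab.trans hb0), sub_self]
      exact mul_nonneg hL (sub_nonneg.2 hab)
    rcases le_total a 0 with ha0 | ha0
    · have := h 0 b le_rfl hb0 hb
      rw [hg.1 0 le_rfl] at this
      rw [hg.1 a ha0]
      nlinarith
    · exact h a b ha0 hab' hb
  have hmono := hg.monotoneOn
  by_cases hz : ∃ z < M, M ≤ g z
  · obtain ⟨z, hzM, hgz⟩ := hz
    have hz0 : 0 < z := by
      by_contra hz0
      linarith [hg.1 z (not_lt.1 hz0)]
    have hL : 0 ≤ (g M - g z) / (M - z) :=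
      div_nonneg (sub_nonneg.2 (hmono hzM.le Set.self_mem_Iic hzM.le)) (sub_pos.2 hzM).le
    have hslope : ∀ a c, 0 ≤ a → a < c → c ≤ z →
        g c - g a ≤ (g M - g z) / (M - z) * (c - a) := by
      intro a c ha hac hcz
      rw [← div_le_iff₀ (sub_pos.2 hac)]
      have hcM := hcz.trans_lt hzM
      have h1 := hg.2.1.slope_mono_adjacent (x := a) (y := c) (z := M)
        ⟨ha, (hac.trans hcM).le⟩ ⟨hM.le, le_rfl⟩ hac hcM
      refine h1.trans ?_
      rcases hcz.eq_or_lt with rfl | hcz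
      · exact le_rfl
      · exact hg.2.1.secant_mono_aux3 ⟨ha.trans hac.le, hcM.le⟩ ⟨hM.le, le_rfl⟩ hcz hzM
    refine ⟨_, hL, fun a b ha hab hb => ?_⟩
    rcases le_or_gt z a with hza | hza
    · have h1 : M ≤ g a := hgz.trans (hmono hzM.le (hab.le.trans hb) hza)
      rw [min_eq_right h1]
      have := mul_nonneg hL (sub_pos.2 hab).le
      linarith [min_le_right (g b) M]
    · have hc : min (g b) M ≤ g (min b z) := by
        rcases le_total b z with h | h
        · rw [min_eq_left h]; exact min_le_left _ _
        · rw [min_eq_right h]; exact (min_le_right _ _).trans hgz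
      have h1 := hslope a (min b z) ha (lt_min hab hza) (min_le_right _ _)
      have h2 := mul_le_mul_of_nonneg_left (sub_le_sub_right (min_le_left b z) a) hL
      have h3 := mul_nonneg hL (sub_pos.2 hab).le
      rcases le_total (g a) M with h | h
      · rw [min_eq_left h]; linarith
      · rw [min_eq_right h]; linarith [min_le_right (g b) M]
  · push Not at hz
    have hid : ∀ z, 0 ≤ z → z < M → g z ≤ z := by
      intro z hz0 hzM
      by_contra! hlt
      have hgM := hz z hzM
      rcases hz0.eq_or_lt with rfl | hz0
      · linarith [hg.1 0 le_rfl]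
      have hgz : 0 < g z := hz0.trans hlt
      have ht : z * M / g z < M := by
        rw [div_lt_iff₀ hgz]; nlinarith
      have hzt : z < z * M / g z := by
        rw [lt_div_iff₀ hgz]; nlinarith
      have h := hg.2.1.secant_mono (a := 0) (x := z) (y := z * M / g z) ⟨le_rfl, hM.le⟩
        ⟨hz0.le, hzM.le⟩ ⟨(hz0.trans hzt).le, ht.le⟩ hz0.ne' (hz0.trans hzt).ne' hzt.le
      rw [hg.1 0 le_rfl, sub_zero, sub_zero, sub_zero, sub_zero,
        le_div_iff₀ (hz0.trans hzt)] at h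
      have : g z / z * (z * M / g z) = M := by field_simp
      linarith [hz _ ht]
    refine ⟨1, zero_le_one, fun a b ha hab hb => ?_⟩
    have haM : a < M := hab.trans_le hb
    have hga : a ≤ g a := by
      have := hg.sub_le_sub le_rfl ha haM.le
      rw [hg.1 0 le_rfl] at this
      linarith
    have hgb : min (g b) M ≤ b := by
      rcases hb.eq_or_lt with rfl | hb
      · exact min_le_right _ _
      · exact (min_le_left _ _).trans (hid b (ha.trans hab.le) hb)
    rw [min_eq_left (hz a haM).le]
    linarith

/-- under Assumptions 1 and 2 the value function of the
manipulation stage is Lipschitz continuous on `[0, M]`. -/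
theorem value_function_lipschitz
    (M : ℝ) (hM : 0 < M) (g : ℝ → ℝ) (hg : Assumption1 M g)
    (Y : ℝ → ℝ) (hY : ∀ w ∈ Set.Icc (0 : ℝ) M, 0 ≤ Y w ∧ Y w ≤ M)
    (hY2 : Assumption2 M Y) :
    ∃ L : ℝ, 0 ≤ L ∧ ∀ x ∈ Set.Icc (0 : ℝ) M, ∀ x' ∈ Set.Icc (0 : ℝ) M,
      |valueFun M g Y x - valueFun M g Y x'| ≤ L * |x - x'| := by
  obtain ⟨L, hL, hmin⟩ := hg.exists_min_sub_min_le hM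
  have hmono := hg.monotoneOn
  have hbdd : ∀ x ∈ Set.Icc (0 : ℝ) M,
      BddAbove ((fun w => Y w - g (w - x)) '' Set.Icc 0 M) := by
    intro x hx
    refine ⟨M, ?_⟩
    rintro _ ⟨w, hw, rfl⟩
    have hgw : 0 ≤ g (w - x) := by
      rw [← hg.1 (-x) (by linarith [hx.1])]
      exact hmono (show -x ≤ M by linarith [hx.1]) (show w - x ≤ M by linarith [hx.1, hw.2])
        (by linarith [hw.1])
    show Y w - g (w - x) ≤ M
    linarith [(hY w hw).2]
  have hne : ∀ x, ((fun w => Y w - g (w - x)) '' Set.Icc 0 M).Nonempty := fun x =>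
    (Set.nonempty_Icc.2 hM.le).image _
  have hle : ∀ x ∈ Set.Icc (0 : ℝ) M, ∀ w ∈ Set.Icc (0 : ℝ) M,
      Y w - g (w - x) ≤ valueFun M g Y x := fun x hx w hw =>
    le_csSup (hbdd x hx) ⟨w, hw, rfl⟩
  have hnonneg : ∀ x ∈ Set.Icc (0 : ℝ) M, 0 ≤ valueFun M g Y x := by
    intro x hx
    have h := hle x hx x hx
    rw [sub_self, hg.1 0 le_rfl] at h
    linarith [(hY x hx).1]
  have key : ∀ x ∈ Set.Icc (0 : ℝ) M, ∀ x' ∈ Set.Icc (0 : ℝ) M, x ≤ x' →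
      |valueFun M g Y x - valueFun M g Y x'| ≤ L * |x - x'| := by
    intro x hx x' hx' hxx
    have h1 : valueFun M g Y x ≤ valueFun M g Y x' := by
      refine csSup_le (hne x) ?_
      rintro _ ⟨w, hw, rfl⟩
      refine le_trans (sub_le_sub_left ?_ _) (hle x' hx' w hw)
      exact hmono (show w - x' ≤ M by linarith [hx'.1, hw.2])
        (show w - x ≤ M by linarith [hx.1, hw.2]) (by linarith)
    have h2 : valueFun M g Y x' ≤ valueFun M g Y x + L * (x' - x) := by
      refine csSup_le (hne x') ?_
      rintro _ ⟨w, hw, rfl⟩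
      have h := hmin (w - x') (w - x) (by linarith) (by linarith [hx.1, hw.2])
      rw [show w - x - (w - x') = x' - x by ring] at h
      have hge := min_le_left (g (w - x')) M
      show Y w - g (w - x') ≤ _
      rcases le_total (g (w - x)) M with hgM | hgM
      · rw [min_eq_left hgM] at h
        linarith [hle x hx w hw]
      · rw [min_eq_right hgM] at h
        linarith [hnonneg x hx, (hY w hw).2]
    rw [abs_sub_comm, abs_sub_comm x, abs_of_nonneg (sub_nonneg.2 h1),
      abs_of_nonneg (sub_nonneg.2 hxx)]
    linarith
  refine ⟨L, hL, fun x hx x' hx' => ?_⟩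
  rcases le_total x x' with h | h
  · exact key x hx x' hx' h
  · rw [abs_sub_comm, abs_sub_comm x]
    exact key x' hx' x hx h
end

section
/- If a contract Y is not nondecreasing on [0, M], i.e., there exist a < b in [0, M] with Y(a) > Y(b), then its monotone envelope Ȳ(x) := sup_{w ∈ [0, x]} Y(w) satisfies Ȳ(x) ≥ Y(x) for every x ∈ [0, M] and Ȳ(b) > Y(b); moreover, under Assumption 1, Ȳ defines the same manipulation-stage value function as Y: sup_{w ∈ [0, M]} (Ȳ(w) − g(w − x)) = sup_{w ∈ [0, M]} (Y(w) − g(w − x)) for every x ∈ [0, M]. -/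
/-- Monotone envelope of a contract: `Ȳ(x) = sup_{w ∈ [0, x]} Y(w)`. -/
noncomputable def monotoneEnvelope (Y : ℝ → ℝ) (x : ℝ) : ℝ :=
  sSup (Y '' Set.Icc 0 x)

open Set Filter Topology

namespace Assumption1

variable {M : ℝ} {g : ℝ → ℝ}

theorem monotoneOn_Ico (hg : Assumption1 M g) : MonotoneOn g (Ico 0 M) := by
  obtain ⟨hzero, -, hderiv, hlim⟩ := hg
  refine monotoneOn_of_deriv_nonneg (convex_Ico 0 M) ?_ ?_ ?_
  · rintro z ⟨hz, hzM⟩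
    rcases hz.eq_or_lt with rfl | hz
    · have hright : ContinuousWithinAt g (Ioi 0) 0 := by
        rwa [ContinuousWithinAt, hzero 0 le_rfl]
      exact (continuousWithinAt_Ioi_iff_Ici.1 hright).mono Ico_subset_Ici_self
    · exact (hderiv z ⟨hz, hzM⟩).1.continuousAt.continuousWithinAt
  · rw [interior_Ico]
    exact fun z hz => (hderiv z hz).1.differentiableWithinAt
  · rw [interior_Ico]
    exact fun z hz => zero_le_one.trans (hderiv z hz).2

theorem monotoneOn_Iic (hg : Assumption1 M g) : MonotoneOn g (Iic M) := by
  have hzero := hg.1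
  have hnonneg : ∀ z, 0 < z → z < M → 0 ≤ g z := fun z hz hzM => by
    simpa [hzero 0 le_rfl] using
      hg.monotoneOn_Ico ⟨le_rfl, hz.trans hzM⟩ ⟨hz.le, hzM⟩ hz.le
  have hpos : ∀ u v, 0 < u → u < v → v ≤ M → g u ≤ g v := fun u v hu huv hvM =>
    hg.2.1.le_right_of_left_le'' ⟨le_rfl, (hu.trans huv).le.trans hvM⟩
      ⟨(hu.trans huv).le, hvM⟩ hu huv.le
      ((hzero 0 le_rfl).trans_le (hnonneg u hu (huv.trans_le hvM)))
  intro u _ v hv huv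
  rcases huv.eq_or_lt with rfl | huv
  · exact le_rfl
  rcases le_or_gt u 0 with hu | hu
  · rw [hzero u hu]
    rcases le_or_gt v 0 with hv0 | hv0
    · exact (hzero v hv0).ge
    · exact (hnonneg (v / 2) (half_pos hv0) ((half_lt_self hv0).trans_le hv)).trans
        (hpos _ _ (half_pos hv0) (half_lt_self hv0) hv)
  · exact hpos u v hu huv hv

theorem nonneg (hg : Assumption1 M g) (hM : 0 ≤ M) {z : ℝ} (hz : z ≤ M) : 0 ≤ g z := by
  rcases le_or_gt z 0 with h | h
  · exact (hg.1 z h).ge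
  · exact (hg.1 0 le_rfl).ge.trans (hg.monotoneOn_Iic hM hz h.le)

end Assumption1

section Envelope

variable {M : ℝ} {Y : ℝ → ℝ}

theorem le_monotoneEnvelope (hY : ∀ w ∈ Icc (0 : ℝ) M, Y w ≤ M) {u x : ℝ}
    (hu : 0 ≤ u) (hux : u ≤ x) (hx : x ≤ M) : Y u ≤ monotoneEnvelope Y x :=
  le_csSup ⟨M, forall_mem_image.2 fun w hw => hY w ⟨hw.1, hw.2.trans hx⟩⟩
    (mem_image_of_mem Y ⟨hu, hux⟩)

theorem monotoneEnvelope_le {x c : ℝ} (hx : 0 ≤ x) (h : ∀ u ∈ Icc 0 x, Y u ≤ c) :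
    monotoneEnvelope Y x ≤ c :=
  csSup_le ((nonempty_Icc.2 hx).image Y) (forall_mem_image.2 h)

theorem sSup_monotoneEnvelope_sub_eq {c : ℝ → ℝ} (hM : 0 ≤ M)
    (hY : ∀ w ∈ Icc (0 : ℝ) M, Y w ≤ M) (hc : ∀ w ∈ Icc (0 : ℝ) M, 0 ≤ c w)
    (hmono : MonotoneOn c (Icc 0 M)) :
    sSup ((fun w => monotoneEnvelope Y w - c w) '' Icc 0 M) =
      sSup ((fun w => Y w - c w) '' Icc 0 M) := by
  have hne : (Icc (0 : ℝ) M).Nonempty := nonempty_Icc.2 hM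
  have hbddY : BddAbove ((fun w => Y w - c w) '' Icc 0 M) :=
    ⟨M, forall_mem_image.2 fun w hw => by linarith [hY w hw, hc w hw]⟩
  have hbddE : BddAbove ((fun w => monotoneEnvelope Y w - c w) '' Icc 0 M) := by
    refine ⟨M, forall_mem_image.2 fun w hw => ?_⟩
    have := monotoneEnvelope_le hw.1 fun u hu => hY u ⟨hu.1, hu.2.trans hw.2⟩
    linarith [hc w hw]
  apply le_antisymm
  · refine csSup_le (hne.image _) (forall_mem_image.2 fun w hw => ?_)
    refine sub_le_iff_le_add.2 (monotoneEnvelope_le hw.1 fun u hu => ?_)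
    have huM : u ∈ Icc 0 M := ⟨hu.1, hu.2.trans hw.2⟩
    have hle : Y u - c u ≤ sSup ((fun w => Y w - c w) '' Icc 0 M) :=
      le_csSup hbddY (mem_image_of_mem (fun w => Y w - c w) huM)
    linarith [hmono huM hw hu.2]
  · refine csSup_le (hne.image _) (forall_mem_image.2 fun w hw => ?_)
    exact (sub_le_sub_right (le_monotoneEnvelope hY hw.1 le_rfl hw.2) _).trans
      (le_csSup hbddE (mem_image_of_mem (fun w => monotoneEnvelope Y w - c w) hw))

end Envelope

/-- if a contract is not nondecreasing on `[0, M]`, its monotone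
envelope dominates it pointwise, strictly at `b`, and under Assumption 1 it
defines the same manipulation-stage value function. -/
theorem monotone_envelope_dominates
    (M : ℝ) (hM : 0 < M) (g : ℝ → ℝ) (hg : Assumption1 M g)
    (Y : ℝ → ℝ) (hY : ∀ w ∈ Set.Icc (0 : ℝ) M, 0 ≤ Y w ∧ Y w ≤ M)
    (a b : ℝ) (ha : a ∈ Set.Icc (0 : ℝ) M) (hb : b ∈ Set.Icc (0 : ℝ) M)
    (hab : a < b) (hdec : Y a > Y b) :
    (∀ x ∈ Set.Icc (0 : ℝ) M, Y x ≤ monotoneEnvelope Y x) ∧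
    monotoneEnvelope Y b > Y b ∧
    (∀ x ∈ Set.Icc (0 : ℝ) M,
      sSup ((fun w => monotoneEnvelope Y w - g (w - x)) '' Set.Icc 0 M) =
      sSup ((fun w => Y w - g (w - x)) '' Set.Icc 0 M)) := by
  have hYM : ∀ w ∈ Icc (0 : ℝ) M, Y w ≤ M := fun w hw => (hY w hw).2
  refine ⟨fun x hx => le_monotoneEnvelope hYM hx.1 le_rfl hx.2,
    hdec.trans_le (le_monotoneEnvelope hYM ha.1 hab.le hb.2), fun x hx => ?_⟩
  have hsub : ∀ w ∈ Icc (0 : ℝ) M, w - x ≤ M := fun w hw => by linarith [hw.2, hx.1]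
  exact sSup_monotoneEnvelope_sub_eq hM.le hYM (fun w hw => hg.nonneg hM.le (hsub w hw))
    fun u hu v hv huv => hg.monotoneOn_Iic (hsub u hu) (hsub v hv) (sub_le_sub_right huv x)
end

section
/- For the linear manipulation technology with interest rate r ≥ 0, the value function of the manipulation stage has slope at most 1 + r: for every contract Y with 0 ≤ Y(w) ≤ M for all w ∈ [0, M], and all x, x' ∈ [0, M] with x ≤ x', it holds that 0 ≤ V(x') − V(x) ≤ (1 + r)·(x' − x). -/
/-- The linear manipulation technology with interest rate `r`:
`g(z) = (1 + r) · max{0, z}`. -/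
noncomputable def linearTech (r : ℝ) (z : ℝ) : ℝ := (1 + r) * max 0 z

theorem linearTech_antitone_sub {r : ℝ} (hr : 0 ≤ r) {x x' : ℝ} (hxx' : x ≤ x') (w : ℝ) :
    linearTech r (w - x') ≤ linearTech r (w - x) := by
  unfold linearTech
  gcongr

theorem linearTech_sub_le {r : ℝ} (hr : 0 ≤ r) {x x' : ℝ} (hxx' : x ≤ x') (w : ℝ) :
    linearTech r (w - x) ≤ linearTech r (w - x') + (1 + r) * (x' - x) := by
  unfold linearTech
  rw [← mul_add]
  gcongr
  refine max_le (add_nonneg (le_max_left _ _) (sub_nonneg.2 hxx')) ?_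
  linarith [le_max_right 0 (w - x')]

theorem bddAbove_image_sub_linearTech {M r : ℝ} (hr : 0 ≤ r) {Y : ℝ → ℝ}
    (hY : ∀ w ∈ Set.Icc (0 : ℝ) M, Y w ≤ M) (x : ℝ) :
    BddAbove ((fun w => Y w - linearTech r (w - x)) '' Set.Icc 0 M) := by
  refine ⟨M, ?_⟩
  rintro _ ⟨w, hw, rfl⟩
  have hg : 0 ≤ linearTech r (w - x) := by unfold linearTech; positivity
  exact (sub_le_self _ hg).trans (hY w hw)

/-- with the linear manipulation technology the value function of
the manipulation stage is nondecreasing with slope at most `1 + r`. -/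
theorem value_function_bounded_slope
    (M : ℝ) (hM : 0 < M) (r : ℝ) (hr : 0 ≤ r)
    (Y : ℝ → ℝ) (hY : ∀ w ∈ Set.Icc (0 : ℝ) M, 0 ≤ Y w ∧ Y w ≤ M)
    (x x' : ℝ) (hx : x ∈ Set.Icc (0 : ℝ) M) (hx' : x' ∈ Set.Icc (0 : ℝ) M)
    (hxx' : x ≤ x') :
    0 ≤ valueFun M (linearTech r) Y x' - valueFun M (linearTech r) Y x ∧
    valueFun M (linearTech r) Y x' - valueFun M (linearTech r) Y x ≤
      (1 + r) * (x' - x) := by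
  have hne (z : ℝ) : ((fun w => Y w - linearTech r (w - z)) '' Set.Icc 0 M).Nonempty :=
    (Set.nonempty_Icc.2 hM.le).image _
  have hbdd := bddAbove_image_sub_linearTech hr fun w hw => (hY w hw).2
  unfold valueFun
  constructor
  · rw [sub_nonneg]
    refine csSup_le (hne x) ?_
    rintro _ ⟨w, hw, rfl⟩
    exact (sub_le_sub_left (linearTech_antitone_sub hr hxx' w) _).trans
      (le_csSup (hbdd x') ⟨w, hw, rfl⟩)
  · rw [sub_le_iff_le_add]
    refine csSup_le (hne x') ?_
    rintro _ ⟨w, hw, rfl⟩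
    have hle := le_csSup (hbdd x) ⟨w, hw, rfl⟩
    dsimp only at hle ⊢
    linarith [linearTech_sub_le hr hxx' w]
end

section
/- For the linear manipulation technology with interest rate r ≥ 0, a function Y : ℝ → ℝ is manipulation-proof on [0, M] if and only if Y is nondecreasing on [0, M] and has slope at most 1 + r on [0, M], i.e., Y(x) ≤ Y(x') and Y(x') − Y(x) ≤ (1 + r)·(x' − x) for all x ≤ x' in [0, M]. -/
/-- `Y` is manipulation-proof on `[0, M]` for the technology `g`:
zero manipulation is always optimal. -/
def ManipulationProof (M : ℝ) (g Y : ℝ → ℝ) : Prop :=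
  ∀ x ∈ Set.Icc (0 : ℝ) M, ∀ w ∈ Set.Icc (0 : ℝ) M, Y w - g (w - x) ≤ Y x

/-- for the linear technology, `Y` is manipulation-proof on
`[0, M]` iff it is nondecreasing with slope at most `1 + r` on `[0, M]`. -/
theorem manipulation_proof_iff_monotone_bounded_slope
    (M : ℝ) (hM : 0 < M) (r : ℝ) (hr : 0 ≤ r) (Y : ℝ → ℝ) :
    ManipulationProof M (linearTech r) Y ↔
      (∀ x ∈ Set.Icc (0 : ℝ) M, ∀ x' ∈ Set.Icc (0 : ℝ) M, x ≤ x' →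
        Y x ≤ Y x' ∧ Y x' - Y x ≤ (1 + r) * (x' - x)) := by
  constructor
  · intro h x hx x' hx' hle
    have h₁ := h x' hx' x hx
    have h₂ := h x hx x' hx'
    rw [linearTech, max_eq_left (sub_nonpos.2 hle)] at h₁
    rw [linearTech, max_eq_right (sub_nonneg.2 hle)] at h₂
    constructor <;> linarith
  · intro h x hx w hw
    rcases le_total x w with hle | hle
    · rw [linearTech, max_eq_right (sub_nonneg.2 hle)]
      linarith [(h x hx w hw hle).2]
    · rw [linearTech, max_eq_left (sub_nonpos.2 hle)]
      linarith [(h w hw x hx hle).1]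
end

section
/- If the manipulation technology satisfies Assumption 4, then every manipulation-proof contract is nondecreasing with slope at most 1, hence continuous: if Y : ℝ → ℝ satisfies Y(w) − g(w − x) ≤ Y(x) for all x, w ∈ [0, M], then for all x ≤ x' in [0, M] it holds that 0 ≤ Y(x') − Y(x) ≤ x' − x. -/
/-- Assumption 4: the manipulation technology `g` vanishes for non-positive
manipulations, is strictly convex on `(0, M)`, is differentiable on `(0, M)`
with `inf_{z ∈ (0, M)} g'(z) = 1`, and tends to `0` as `z → 0⁺`. -/
def Assumption4 (M : ℝ) (g : ℝ → ℝ) : Prop :=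
  (∀ z ≤ (0 : ℝ), g z = 0) ∧
  StrictConvexOn ℝ (Set.Ioo 0 M) g ∧
  (∀ z ∈ Set.Ioo (0 : ℝ) M, DifferentiableAt ℝ g z) ∧
  IsGLB (deriv g '' Set.Ioo (0 : ℝ) M) 1 ∧
  Filter.Tendsto g (nhdsWithin 0 (Set.Ioi 0)) (nhds 0)

/-- A convex function on `(0, M)` with right limit `0` at the origin is bounded on `(0, c)` by the
linear function with slope `deriv g c`. -/
theorem ConvexOn.le_deriv_mul_of_tendsto_zero {M : ℝ} {g : ℝ → ℝ}
    (hconv : ConvexOn ℝ (Set.Ioo 0 M) g)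
    (hlim : Filter.Tendsto g (nhdsWithin 0 (Set.Ioi 0)) (nhds 0))
    {c z : ℝ} (hc : c ∈ Set.Ioo 0 M) (hdiff : DifferentiableAt ℝ g c)
    (hz : 0 < z) (hzc : z < c) : g z ≤ deriv g c * z := by
  have hzM : z ∈ Set.Ioo 0 M := ⟨hz, hzc.trans hc.2⟩
  have hbound : ∀ᶠ t in nhdsWithin (0 : ℝ) (Set.Ioi 0), g z - g t ≤ deriv g c * (z - t) := by
    filter_upwards [Ioo_mem_nhdsGT hz] with t ht
    have h₁ := hconv.slope_mono_adjacent ⟨ht.1, ht.2.trans hzM.2⟩ hc ht.2 hzc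
    have h₂ := hconv.slope_le_deriv hzM hc hzc hdiff
    rw [slope_def_field] at h₂
    exact (div_le_iff₀ (sub_pos.2 ht.2)).1 (h₁.trans h₂)
  have hid : Filter.Tendsto (fun t : ℝ => t) (nhdsWithin 0 (Set.Ioi 0)) (nhds 0) :=
    tendsto_nhdsWithin_of_tendsto_nhds Filter.tendsto_id
  have h := le_of_tendsto_of_tendsto (hlim.const_sub (g z))
    ((hid.const_sub z).const_mul (deriv g c)) hbound
  simpa using h

/-- If increments of `Y` over steps of length less than `c` are at most `K` times the step, then
so are all increments. -/
theorem sub_le_mul_sub_of_small_steps {M K c : ℝ} (hc : 0 < c) {Y : ℝ → ℝ}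
    (hY : ∀ x ∈ Set.Icc (0 : ℝ) M, ∀ w ∈ Set.Icc (0 : ℝ) M, 0 < w - x → w - x < c →
      Y w - Y x ≤ K * (w - x))
    {x x' : ℝ} (hx : x ∈ Set.Icc (0 : ℝ) M) (hx' : x' ∈ Set.Icc (0 : ℝ) M) (hlt : x < x') :
    Y x' - Y x ≤ K * (x' - x) := by
  obtain ⟨n, hn⟩ := exists_nat_gt ((x' - x) / c)
  have hd : 0 < x' - x := sub_pos.2 hlt
  have hn0 : (0 : ℝ) < n := (div_pos hd hc).trans hn
  set d := (x' - x) / n with hd_def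
  have hdpos : 0 < d := div_pos hd hn0
  have hdc : d < c := by
    rw [div_lt_iff₀ hc] at hn
    rw [hd_def, div_lt_iff₀ hn0]
    linarith
  have hnd : n * d = x' - x := mul_div_cancel₀ _ hn0.ne'
  have hsteps : ∀ k : ℕ, k ≤ n → Y (x + k * d) - Y x ≤ K * (k * d) := by
    intro k
    induction k with
    | zero => simp
    | succ k ih =>
      intro hk
      have hkn : ((k + 1 : ℕ) : ℝ) * d ≤ n * d := by gcongr
      have hk0 : 0 ≤ (k : ℝ) * d := by positivity
      push_cast at hkn ⊢
      have h := hY (x + k * d) ⟨by linarith [hx.1], by linarith [hx'.2]⟩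
        (x + (k + 1) * d) ⟨by linarith [hx.1], by linarith [hx'.2]⟩
        (by linarith) (by linarith)
      have := ih (by omega)
      linarith
  have h := hsteps n le_rfl
  rwa [hnd, add_sub_cancel] at h

/-- under Assumption 4, every manipulation-proof contract is
nondecreasing with slope at most `1` on `[0, M]`. -/
theorem manipulation_proof_nondecreasing_slope_le_one
    (M : ℝ) (hM : 0 < M) (g : ℝ → ℝ) (hg : Assumption4 M g)
    (Y : ℝ → ℝ)
    (hMP : ∀ x ∈ Set.Icc (0 : ℝ) M, ∀ w ∈ Set.Icc (0 : ℝ) M,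
      Y w - g (w - x) ≤ Y x) :
    ∀ x ∈ Set.Icc (0 : ℝ) M, ∀ x' ∈ Set.Icc (0 : ℝ) M, x ≤ x' →
      0 ≤ Y x' - Y x ∧ Y x' - Y x ≤ x' - x := by
  obtain ⟨hzero, hconv, hdiff, hinf, hlim⟩ := hg
  intro x hx x' hx' hle
  constructor
  · have h := hMP x' hx' x hx
    rw [hzero _ (sub_nonpos.2 hle)] at h
    linarith
  rcases hle.eq_or_lt with rfl | hlt
  · simp
  have hd : 0 < x' - x := sub_pos.2 hlt
  rw [← div_le_one hd]
  refine (le_isGLB_iff hinf).2 ?_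
  rintro _ ⟨c, hc, rfl⟩
  rw [div_le_iff₀ hd]
  refine sub_le_mul_sub_of_small_steps hc.1 (fun y hy w hw hpos hsmall => ?_) hx hx' hlt
  have h := hMP y hy w hw
  have h' := hconv.convexOn.le_deriv_mul_of_tendsto_zero hlim hc (hdiff c hc) hpos hsmall
  linarith
end

section
/- For a strictly convex manipulation cost, the long-jump interim incentive constraint is slack when the two short-jump constraints bind: let g : ℝ → ℝ satisfy g(z) = 0 for z ≤ 0, g strictly convex on (0, ∞), and g(z) → 0 as z → 0⁺. Let x_l < x_m < x_h be reals and let payments satisfy y_m = y_l + g(x_m − x_l) and y_h = y_m + g(x_h − x_m) (the constraints IIC_{l,m} and IIC_{m,h} hold with equality). Then y_h − g(x_h − x_l) < y_l, i.e., the constraint IIC_{l,h} is slack. -/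
open Filter Topology in
/-- A convex function on `(0, ∞)` vanishing at `0⁺` has `g z / z` nondecreasing. -/
lemma ConvexOn.mul_le_mul_of_tendsto_zero {g : ℝ → ℝ} (hg : ConvexOn ℝ (Set.Ioi 0) g)
    (hlim : Tendsto g (𝓝[>] 0) (𝓝 0)) {u c : ℝ} (hu : 0 < u) (huc : u < c) :
    c * g u ≤ u * g c := by
  have hid : Tendsto (fun e : ℝ => e) (𝓝[>] 0) (𝓝 0) := nhdsWithin_le_nhds
  have hle : (g u - 0) * (c - u) ≤ (g c - g u) * (u - 0) := by
    refine le_of_tendsto_of_tendsto ((hlim.const_sub (g u)).mul_const (c - u))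
      ((hid.const_sub u).const_mul (g c - g u)) ?_
    filter_upwards [Ioo_mem_nhdsGT hu] with e he
    have hslope := hg.slope_mono_adjacent he.1 (hu.trans huc) he.2 huc
    rwa [div_le_div_iff₀ (sub_pos.2 he.2) (sub_pos.2 huc)] at hslope
  linarith

open Filter Topology in
/-- A strictly convex function on `(0, ∞)` vanishing at `0⁺` has `g z / z` strictly increasing. -/
lemma StrictConvexOn.mul_lt_mul_of_tendsto_zero {g : ℝ → ℝ} (hg : StrictConvexOn ℝ (Set.Ioi 0) g)
    (hlim : Tendsto g (𝓝[>] 0) (𝓝 0)) {u c : ℝ} (hu : 0 < u) (huc : u < c) :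
    c * g u < u * g c := by
  obtain ⟨v, huv, hvc⟩ := exists_between huc
  have hslope := hg.slope_strict_mono_adjacent hu (hu.trans huc) huv hvc
  rw [div_lt_div_iff₀ (sub_pos.2 huv) (sub_pos.2 hvc)] at hslope
  have hle := mul_le_mul_of_nonneg_right
    (hg.convexOn.mul_le_mul_of_tendsto_zero hlim hu huv) (sub_pos.2 huc).le
  have hlt := mul_lt_mul_of_pos_left hslope hu
  refine lt_of_mul_lt_mul_right ?_ (sub_pos.2 huv).le
  linarith

open Filter Topology in
/-- A strictly convex function on `(0, ∞)` vanishing at `0⁺` is strictly superadditive. -/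
lemma StrictConvexOn.add_lt_of_tendsto_zero {g : ℝ → ℝ} (hg : StrictConvexOn ℝ (Set.Ioi 0) g)
    (hlim : Tendsto g (𝓝[>] 0) (𝓝 0)) {a b : ℝ} (ha : 0 < a) (hb : 0 < b) :
    g a + g b < g (a + b) := by
  have h₁ := hg.mul_lt_mul_of_tendsto_zero hlim ha (lt_add_of_pos_right a hb)
  have h₂ := hg.mul_lt_mul_of_tendsto_zero hlim hb (lt_add_of_pos_left b ha)
  refine lt_of_mul_lt_mul_left ?_ (add_pos ha hb).le
  linarith

/-- for a strictly convex manipulation cost, if the two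
short-jump interim incentive constraints bind, then the long-jump constraint
`IIC_{l,h}` is slack. -/
theorem long_jump_constraint_slack
    (g : ℝ → ℝ) (hg0 : ∀ z ≤ (0 : ℝ), g z = 0)
    (hgconv : StrictConvexOn ℝ (Set.Ioi 0) g)
    (hglim : Filter.Tendsto g (nhdsWithin 0 (Set.Ioi 0)) (nhds 0))
    (xl xm xh yl ym yh : ℝ) (hlm : xl < xm) (hmh : xm < xh)
    (hIIClm : ym = yl + g (xm - xl))
    (hIICmh : yh = ym + g (xh - xm)) :
    yh - g (xh - xl) < yl := by
  have h := hgconv.add_lt_of_tendsto_zero hglim (sub_pos.2 hlm) (sub_pos.2 hmh)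
  rw [show xm - xl + (xh - xm) = xh - xl by ring] at h
  linarith
end

section
/- For a strictly convex manipulation cost, a contract for which the long-jump constraint binds must violate a short-jump constraint: let g : ℝ → ℝ satisfy g(z) = 0 for z ≤ 0, g strictly convex on (0, ∞), and g(z) → 0 as z → 0⁺. Let x_l < x_m < x_h be reals and let payments satisfy y_h = y_l + g(x_h − x_l) (IIC_{l,h} binds) and y_m − g(x_m − x_l) ≤ y_l (IIC_{l,m} holds). Then y_h − g(x_h − x_m) > y_m, i.e., the constraint IIC_{m,h} is violated. -/
/-- Spreading two points apart while preserving their sum strictly increases the sum of the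
values of a strictly convex function. -/
theorem StrictConvexOn.add_lt_add_of_lt_of_lt {s : Set ℝ} {f : ℝ → ℝ}
    (hf : StrictConvexOn ℝ s f) {x u v : ℝ} (hx : x ∈ s) (hy : u + v - x ∈ s)
    (hu : x < u) (hv : x < v) : f u + f v < f x + f (u + v - x) := by
  have hd : 0 < u - x + (v - x) := by linarith
  have hxy : x ≠ u + v - x := by linarith
  have hp : 0 < (u - x) / (u - x + (v - x)) := div_pos (by linarith) hd
  have hq : 0 < (v - x) / (u - x + (v - x)) := div_pos (by linarith) hd
  have hpq : (u - x) / (u - x + (v - x)) + (v - x) / (u - x + (v - x)) = 1 := by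
    rw [← add_div, div_self hd.ne']
  have hpd : (u - x) / (u - x + (v - x)) * (u - x + (v - x)) = u - x :=
    div_mul_cancel₀ _ hd.ne'
  generalize (u - x) / (u - x + (v - x)) = p at *
  generalize (v - x) / (u - x + (v - x)) = q at *
  obtain rfl : q = 1 - p := by linarith
  have h₁ := hf.2 hx hy hxy hq hp (by ring)
  have h₂ := hf.2 hx hy hxy hp hq (by ring)
  simp only [smul_eq_mul] at h₁ h₂
  rw [show (1 - p) * x + p * (u + v - x) = u by linear_combination hpd] at h₁
  rw [show p * x + (1 - p) * (u + v - x) = v by linear_combination -hpd] at h₂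
  linarith

/-- A strictly convex function on `(0, ∞)` with right limit `0` at `0` is strictly
superadditive. -/
theorem StrictConvexOn.add_lt_map_add_of_tendsto_zero {f : ℝ → ℝ}
    (hf : StrictConvexOn ℝ (Set.Ioi 0) f)
    (hlim : Filter.Tendsto f (nhdsWithin 0 (Set.Ioi 0)) (nhds 0))
    {a b : ℝ} (ha : 0 < a) (hb : 0 < b) : f a + f b < f (a + b) := by
  obtain ⟨d, hd, hdab⟩ := exists_between (lt_min ha hb)
  obtain ⟨hda, hdb⟩ := lt_min_iff.1 hdab
  have hcont : ContinuousAt f (a + b) :=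
    (hf.convexOn.continuousOn isOpen_Ioi).continuousAt (Ioi_mem_nhds (by linarith))
  have hsub : Filter.Tendsto (fun e : ℝ => a + b - e) (nhdsWithin 0 (Set.Ioi 0))
      (nhds (a + b)) := by
    have h : Continuous fun e : ℝ => a + b - e := by fun_prop
    simpa using (h.tendsto 0).mono_left nhdsWithin_le_nhds
  have hsum : Filter.Tendsto (fun e : ℝ => f e + f (a + b - e)) (nhdsWithin 0 (Set.Ioi 0))
      (nhds (f (a + b))) := by
    simpa using hlim.add (hcont.tendsto.comp hsub)
  have hle : f d + f (a + b - d) ≤ f (a + b) := by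
    refine ge_of_tendsto hsum ?_
    filter_upwards [Ioo_mem_nhdsGT hd] with e he
    have h := hf.add_lt_add_of_lt_of_lt (x := e) (u := d) (v := a + b - d) he.1
      (Set.mem_Ioi.2 (by linarith [he.2])) he.2 (by linarith [he.2])
    rw [add_sub_cancel] at h
    exact h.le
  exact (hf.add_lt_add_of_lt_of_lt hd (Set.mem_Ioi.2 (by linarith)) hda hdb).trans_le hle


/-- for a strictly convex manipulation cost, if the long-jump
constraint `IIC_{l,h}` binds and `IIC_{l,m}` holds, then the constraint
`IIC_{m,h}` is violated. -/
theorem short_jump_constraint_violated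
    (g : ℝ → ℝ) (hg0 : ∀ z ≤ (0 : ℝ), g z = 0)
    (hgconv : StrictConvexOn ℝ (Set.Ioi 0) g)
    (hglim : Filter.Tendsto g (nhdsWithin 0 (Set.Ioi 0)) (nhds 0))
    (xl xm xh yl ym yh : ℝ) (hlm : xl < xm) (hmh : xm < xh)
    (hIIClh : yh = yl + g (xh - xl))
    (hIIClm : ym - g (xm - xl) ≤ yl) :
    yh - g (xh - xm) > ym := by
  have h := hgconv.add_lt_map_add_of_tendsto_zero hglim (sub_pos.2 hlm) (sub_pos.2 hmh)
  rw [show xm - xl + (xh - xm) = xh - xl by ring] at h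
  linarith
end

section
/- The pointwise likelihood ratio condition implies the set-wise likelihood ratio condition: let f, g : ℝ → ℝ be nonnegative Lebesgue-integrable functions with f(x)·g(y) ≥ f(y)·g(x) whenever x ≤ y, and let A, B ⊆ ℝ be measurable sets such that a ≤ b for every a ∈ A and b ∈ B. Then (∫_A f)·(∫_B g) ≥ (∫_B f)·(∫_A g). -/
open MeasureTheory

/-- the pointwise likelihood ratio condition implies the
set-wise likelihood ratio condition: if `f(x)·g(y) ≥ f(y)·g(x)` for all
`x ≤ y` and `A ≤ B` (every element of `A` is below every element of `B`),
then `(∫_A f)·(∫_B g) ≥ (∫_B f)·(∫_A g)`. -/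
theorem pointwise_lr_implies_setwise_lr
    (f g : ℝ → ℝ) (hf0 : ∀ x, 0 ≤ f x) (hg0 : ∀ x, 0 ≤ g x)
    (hfint : Integrable f) (hgint : Integrable g)
    (hLR : ∀ x y : ℝ, x ≤ y → f y * g x ≤ f x * g y)
    (A B : Set ℝ) (hA : MeasurableSet A) (hB : MeasurableSet B)
    (hAB : ∀ a ∈ A, ∀ b ∈ B, a ≤ b) :
    (∫ x in B, f x) * (∫ x in A, g x) ≤ (∫ x in A, f x) * (∫ x in B, g x) := by
  rw [mul_comm (∫ x in B, f x), ← setIntegral_prod_mul g f A B, ← setIntegral_prod_mul f g A B]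
  refine setIntegral_mono_on (hgint.mul_prod hfint).integrableOn
    (hfint.mul_prod hgint).integrableOn (hA.prod hB) fun z hz => ?_
  rw [mul_comm (g z.1)]
  exact hLR z.1 z.2 (hAB z.1 hz.1 z.2 hz.2)
end
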